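/- arXiv:0811.2323 — 7 statements merged into one kernel-verified Lean document; each statement's English description precedes it below -/
import Mathlib

section
/- Let ρ₁, ρ₂ be density matrices on ℂ^N, let P₊ and P₋ be the orthogonal projectors onto the subspaces spanned by the eigenvectors of the Hermitian matrix ρ₁ − ρ₂ with positive and negative eigenvalues respectively. Then tr(ρ₁ (I − ρ₁)) ≥ tr(P₊ (I − ρ₁) ρ₂) + tr(P₋ ρ₁ (I − ρ₂)). -/
open Matrix ComplexOrder

/-- The orthogonal projector onto the subspace spanned by the eigenvectors of a
Hermitian matrix `A` corresponding to positive eigenvalues. -/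
noncomputable def posProj {n : Type*} [Fintype n] [DecidableEq n]
    {A : Matrix n n ℂ} (hA : A.IsHermitian) : Matrix n n ℂ :=
  (hA.eigenvectorUnitary : Matrix n n ℂ) *
    Matrix.diagonal (fun i => if 0 < hA.eigenvalues i then (1 : ℂ) else 0) *
    (hA.eigenvectorUnitary : Matrix n n ℂ)ᴴ

/-- The orthogonal projector onto the subspace spanned by the eigenvectors of a
Hermitian matrix `A` corresponding to negative eigenvalues. -/
noncomputable def negProj {n : Type*} [Fintype n] [DecidableEq n]
    {A : Matrix n n ℂ} (hA : A.IsHermitian) : Matrix n n ℂ :=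
  (hA.eigenvectorUnitary : Matrix n n ℂ) *
    Matrix.diagonal (fun i => if hA.eigenvalues i < 0 then (1 : ℂ) else 0) *
    (hA.eigenvectorUnitary : Matrix n n ℂ)ᴴ

open scoped MatrixOrder in
/-- The trace of a product of two positive semidefinite matrices has nonnegative real part. -/
theorem Matrix.PosSemidef.re_trace_mul_nonneg {n : Type*} [Fintype n]
    {A B : Matrix n n ℂ} (hA : A.PosSemidef) (hB : B.PosSemidef) : 0 ≤ ((A * B).trace).re := by
  classical
  obtain ⟨C, rfl⟩ := CStarAlgebra.nonneg_iff_eq_star_mul_self.mp hB.nonneg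
  rw [← mul_assoc, Matrix.trace_mul_comm, ← mul_assoc]
  exact (Complex.nonneg_iff.mp (hA.mul_mul_conjTranspose_same C).trace_nonneg).1

namespace Matrix.IsHermitian

variable {n : Type*} [Fintype n] [DecidableEq n] {A : Matrix n n ℂ}

/-- The matrix that is diagonal, with diagonal `d`, in the eigenbasis of the Hermitian
matrix `A`. -/
noncomputable def eigenDiagonal (hA : A.IsHermitian) (d : n → ℂ) : Matrix n n ℂ :=
  (hA.eigenvectorUnitary : Matrix n n ℂ) * Matrix.diagonal d *
    (hA.eigenvectorUnitary : Matrix n n ℂ)ᴴ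

theorem eigenDiagonal_eigenvalues (hA : A.IsHermitian) :
    hA.eigenDiagonal (fun i => (hA.eigenvalues i : ℂ)) = A :=
  hA.spectral_theorem.symm

theorem eigenDiagonal_one (hA : A.IsHermitian) : hA.eigenDiagonal 1 = 1 := by
  rw [eigenDiagonal, show diagonal (1 : n → ℂ) = 1 from diagonal_one, mul_one]
  exact Unitary.mul_star_self_of_mem hA.eigenvectorUnitary.2

theorem eigenDiagonal_zero (hA : A.IsHermitian) : hA.eigenDiagonal 0 = 0 := by
  simp [eigenDiagonal]

theorem eigenDiagonal_mul (hA : A.IsHermitian) (d e : n → ℂ) :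
    hA.eigenDiagonal (d * e) = hA.eigenDiagonal d * hA.eigenDiagonal e := by
  have hU : (hA.eigenvectorUnitary : Matrix n n ℂ)ᴴ * (hA.eigenvectorUnitary : Matrix n n ℂ) = 1 :=
    Unitary.star_mul_self_of_mem hA.eigenvectorUnitary.2
  simp only [eigenDiagonal, mul_assoc]
  rw [← mul_assoc _ᴴ, hU, one_mul, ← mul_assoc (diagonal d), diagonal_mul_diagonal]
  rfl

theorem eigenDiagonal_sub (hA : A.IsHermitian) (d e : n → ℂ) :
    hA.eigenDiagonal (d - e) = hA.eigenDiagonal d - hA.eigenDiagonal e := by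
  simp only [eigenDiagonal, ← mul_sub, ← sub_mul, diagonal_sub]
  rfl

theorem posSemidef_eigenDiagonal (hA : A.IsHermitian) {d : n → ℂ} (hd : 0 ≤ d) :
    (hA.eigenDiagonal d).PosSemidef :=
  (PosSemidef.diagonal hd).mul_mul_conjTranspose_same _

theorem commute_eigenDiagonal (hA : A.IsHermitian) (d : n → ℂ) : Commute (hA.eigenDiagonal d) A := by
  have h := hA.eigenDiagonal_mul d (fun i => (hA.eigenvalues i : ℂ))
  rw [mul_comm, eigenDiagonal_mul, eigenDiagonal_eigenvalues] at h
  exact h.symm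

theorem posSemidef_eigenDiagonal_mul (hA : A.IsHermitian) {d : n → ℂ}
    (hd : ∀ i, 0 ≤ d i * (hA.eigenvalues i : ℂ)) : (hA.eigenDiagonal d * A).PosSemidef := by
  have h := hA.eigenDiagonal_mul d (fun i => (hA.eigenvalues i : ℂ))
  rw [eigenDiagonal_eigenvalues] at h
  exact h ▸ hA.posSemidef_eigenDiagonal hd

theorem commute_posProj (hA : A.IsHermitian) : Commute (posProj hA) A :=
  hA.commute_eigenDiagonal _

theorem commute_negProj (hA : A.IsHermitian) : Commute (negProj hA) A :=
  hA.commute_eigenDiagonal _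

theorem posSemidef_posProj_mul (hA : A.IsHermitian) : (posProj hA * A).PosSemidef := by
  refine hA.posSemidef_eigenDiagonal_mul fun i => ?_
  split_ifs with h
  · simpa using h.le
  · simp

theorem posSemidef_neg_negProj_mul (hA : A.IsHermitian) : (-(negProj hA * A)).PosSemidef := by
  have h : -negProj hA = hA.eigenDiagonal (fun i => if hA.eigenvalues i < 0 then -1 else 0) := by
    have := hA.eigenDiagonal_sub 0 (fun i => if hA.eigenvalues i < 0 then 1 else 0)
    rw [eigenDiagonal_zero, zero_sub, zero_sub] at this
    rw [negProj, ← eigenDiagonal, ← this]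
    congr 1
    ext i
    simp [apply_ite]
  rw [← neg_mul, h]
  refine hA.posSemidef_eigenDiagonal_mul fun i => ?_
  split_ifs with h
  · simpa using mod_cast h.le
  · simp

theorem posSemidef_one_sub_posProj_sub_negProj (hA : A.IsHermitian) :
    (1 - posProj hA - negProj hA).PosSemidef := by
  rw [posProj, negProj, ← eigenDiagonal, ← eigenDiagonal, ← hA.eigenDiagonal_one,
    ← eigenDiagonal_sub, ← eigenDiagonal_sub]
  refine hA.posSemidef_eigenDiagonal fun i => ?_
  rcases lt_trichotomy (hA.eigenvalues i) 0 with h | h | h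
  · simp [h, h.not_gt]
  · simp [h]
  · simp [h, h.not_gt]

end Matrix.IsHermitian

/-- A positive semidefinite matrix of trace one is bounded above by the identity. -/
theorem Matrix.PosSemidef.one_sub_of_trace_eq_one {n : Type*} [Fintype n] [DecidableEq n]
    {A : Matrix n n ℂ} (hA : A.PosSemidef) (htr : A.trace = 1) : (1 - A).PosSemidef := by
  have h := hA.isHermitian.eigenDiagonal_sub 1 (fun i => (hA.isHermitian.eigenvalues i : ℂ))
  rw [hA.isHermitian.eigenDiagonal_one, hA.isHermitian.eigenDiagonal_eigenvalues] at h
  rw [← h]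
  refine hA.isHermitian.posSemidef_eigenDiagonal fun i => ?_
  have hsum : ∑ j, hA.isHermitian.eigenvalues j = 1 := by
    have := hA.isHermitian.trace_eq_sum_eigenvalues
    rw [htr] at this
    exact Complex.ofReal_injective (by simpa using this.symm)
  have hle : hA.isHermitian.eigenvalues i ≤ 1 :=
    hsum ▸ Finset.single_le_sum (fun j _ => hA.eigenvalues_nonneg j) (Finset.mem_univ i)
  simpa using mod_cast hle

/-- If `A` and `1 - A` are positive semidefinite, then so is `A * (1 - A)`. -/
theorem Matrix.PosSemidef.mul_one_sub {n : Type*} [Fintype n] [DecidableEq n]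
    {A : Matrix n n ℂ} (hA : A.PosSemidef) (hA' : (1 - A).PosSemidef) :
    (A * (1 - A)).PosSemidef := by
  have h := (hA'.mul_mul_conjTranspose_same A).add (hA.mul_mul_conjTranspose_same (1 - A))
  rw [hA.isHermitian.eq, hA'.isHermitian.eq] at h
  convert h using 1
  noncomm_ring

theorem trace_rho1_one_sub_rho1_ge_sum {N : ℕ} (ρ₁ ρ₂ : Matrix (Fin N) (Fin N) ℂ)
    (h₁ : ρ₁.PosSemidef) (h₁' : ρ₁.trace = 1)
    (h₂ : ρ₂.PosSemidef) (h₂' : ρ₂.trace = 1) :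
    ((ρ₁ * (1 - ρ₁)).trace).re ≥
      ((posProj (h₁.isHermitian.sub h₂.isHermitian) * (1 - ρ₁) * ρ₂).trace).re + ((negProj (h₁.isHermitian.sub h₂.isHermitian) * ρ₁ * (1 - ρ₂)).trace).re := by
  set hD := h₁.isHermitian.sub h₂.isHermitian
  have hP := hD.posSemidef_posProj_mul
  have hQ := hD.posSemidef_neg_negProj_mul
  have hZ := hD.posSemidef_one_sub_posProj_sub_negProj
  have hcP := hD.commute_posProj.eq
  have hcQ := hD.commute_negProj.eq
  generalize posProj hD = P at *
  generalize negProj hD = Q at *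
  have h₁'' := h₁.one_sub_of_trace_eq_one h₁'
  have hzero := hZ.re_trace_mul_nonneg (h₁.mul_one_sub h₁'')
  have hpos := h₁''.re_trace_mul_nonneg hP
  have hneg := h₁.re_trace_mul_nonneg hQ
  obtain ⟨D, hD'⟩ : ∃ D, D = ρ₁ - ρ₂ := ⟨_, rfl⟩
  obtain rfl : ρ₂ = ρ₁ - D := by rw [hD', sub_sub_cancel]
  rw [← hD'] at hcP hcQ hpos hneg
  have htrace {R : Matrix (Fin N) (Fin N) ℂ} (hR : R * D = D * R) :
      (R * (ρ₁ * D)).trace = (ρ₁ * (R * D)).trace := by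
    rw [← mul_assoc, Matrix.trace_mul_comm, ← mul_assoc, ← hR, Matrix.trace_mul_comm]
  have htP := congrArg Complex.re (htrace hcP)
  have htQ := congrArg Complex.re (htrace hcQ)
  simp only [mul_assoc, mul_sub, sub_mul, mul_one, one_mul, mul_neg, Matrix.trace_sub,
    Matrix.trace_neg, Complex.sub_re, Complex.neg_re] at *
  linarith
end

section
/- Let ρ₁, ρ₂ be density matrices on ℂ^N, let P₊ and P₋ be the orthogonal projectors onto the subspaces spanned by the eigenvectors of the Hermitian matrix ρ₁ − ρ₂ with positive and negative eigenvalues respectively. Then tr(ρ₂ (I − ρ₂)) ≥ tr(P₊ (I − ρ₁) ρ₂) + tr(P₋ ρ₁ (I − ρ₂)). -/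
open Matrix ComplexOrder

namespace Matrix

lemma PosSemidef.re_trace_mul_nonneg_s6 {n : Type*} [Fintype n] {A B : Matrix n n ℂ} (hA : A.PosSemidef) (hB : B.PosSemidef) :
    0 ≤ (A * B).trace.re := by
  obtain ⟨m, v, rfl⟩ := posSemidef_iff_eq_sum_vecMulVec.mp hB
  rw [Matrix.mul_sum, trace_sum, Complex.re_sum]
  refine Finset.sum_nonneg fun i _ => ?_
  rw [mul_vecMulVec, trace_vecMulVec, dotProduct_comm]
  exact (Complex.nonneg_iff.mp (hA.dotProduct_mulVec_nonneg (v i))).1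

variable {n : Type*} [Fintype n] [DecidableEq n] {A : Matrix n n ℂ}

namespace IsHermitian

lemma cfc_mul_cfc (hA : A.IsHermitian) (f g : ℝ → ℝ) :
    hA.cfc f * hA.cfc g = hA.cfc (f * g) := by
  rw [IsHermitian.cfc, IsHermitian.cfc, IsHermitian.cfc, ← map_mul, diagonal_mul_diagonal]
  congr 2
  ext i
  simp

lemma cfc_add_cfc (hA : A.IsHermitian) (f g : ℝ → ℝ) :
    hA.cfc f + hA.cfc g = hA.cfc (f + g) := by
  rw [IsHermitian.cfc, IsHermitian.cfc, IsHermitian.cfc, ← map_add, diagonal_add]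
  congr 2
  ext i
  simp

lemma neg_cfc (hA : A.IsHermitian) (f : ℝ → ℝ) : -hA.cfc f = hA.cfc (-f) := by
  rw [IsHermitian.cfc, IsHermitian.cfc, ← map_neg, diagonal_neg]
  congr 2
  ext i
  simp

lemma cfc_sub_cfc (hA : A.IsHermitian) (f g : ℝ → ℝ) :
    hA.cfc f - hA.cfc g = hA.cfc (f - g) := by
  rw [sub_eq_add_neg, neg_cfc, cfc_add_cfc, ← sub_eq_add_neg]

lemma cfc_id_eq_self (hA : A.IsHermitian) : hA.cfc id = A :=
  hA.spectral_theorem.symm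

lemma cfc_one_eq_one (hA : A.IsHermitian) : hA.cfc 1 = 1 := by
  rw [IsHermitian.cfc, ← map_one (Unitary.conjStarAlgAut ℂ _ hA.eigenvectorUnitary), ← diagonal_one]
  congr 2

lemma posSemidef_cfc (hA : A.IsHermitian) {f : ℝ → ℝ} (hf : ∀ i, 0 ≤ f (hA.eigenvalues i)) :
    (hA.cfc f).PosSemidef := by
  rw [IsHermitian.cfc, Unitary.conjStarAlgAut_apply]
  exact (PosSemidef.diagonal fun i => Complex.zero_le_real.mpr (hf i)).mul_mul_conjTranspose_same _

end IsHermitian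

lemma PosSemidef.eigenvalues_le_one (hA : A.PosSemidef) (htr : A.trace = 1) (i : n) :
    hA.isHermitian.eigenvalues i ≤ 1 := by
  have hsum : ∑ j, hA.isHermitian.eigenvalues j = 1 := by
    have := hA.isHermitian.trace_eq_sum_eigenvalues
    rw [htr] at this
    exact Complex.ofReal_injective (by simpa using this.symm)
  rw [← hsum]
  exact Finset.single_le_sum (fun j _ => hA.eigenvalues_nonneg j) (Finset.mem_univ i)

lemma PosSemidef.one_sub_of_trace_eq_one_s6 (hA : A.PosSemidef) (htr : A.trace = 1) :
    (1 - A).PosSemidef := by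
  have h : 1 - A = hA.isHermitian.cfc (1 - id) := by
    rw [← hA.isHermitian.cfc_sub_cfc, hA.isHermitian.cfc_one_eq_one, hA.isHermitian.cfc_id_eq_self]
  rw [h]
  exact hA.isHermitian.posSemidef_cfc fun i => sub_nonneg.mpr (hA.eigenvalues_le_one htr i)

lemma PosSemidef.mul_one_sub_of_trace_eq_one (hA : A.PosSemidef) (htr : A.trace = 1) :
    (A * (1 - A)).PosSemidef := by
  have h : A * (1 - A) = hA.isHermitian.cfc (id * (1 - id)) := by
    rw [← hA.isHermitian.cfc_mul_cfc, ← hA.isHermitian.cfc_sub_cfc, hA.isHermitian.cfc_one_eq_one,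
      hA.isHermitian.cfc_id_eq_self]
  rw [h]
  exact hA.isHermitian.posSemidef_cfc fun i =>
    mul_nonneg (hA.eigenvalues_nonneg i) (sub_nonneg.mpr (hA.eigenvalues_le_one htr i))

end Matrix

section Projectors

variable {n : Type*} [Fintype n] [DecidableEq n] {A : Matrix n n ℂ}

lemma posProj_eq_cfc (hA : A.IsHermitian) :
    posProj hA = hA.cfc fun x => if 0 < x then 1 else 0 := by
  rw [posProj, IsHermitian.cfc, Unitary.conjStarAlgAut_apply, star_eq_conjTranspose]
  congr 3
  ext i
  simp [apply_ite]

lemma negProj_eq_cfc (hA : A.IsHermitian) :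
    negProj hA = hA.cfc fun x => if x < 0 then 1 else 0 := by
  rw [negProj, IsHermitian.cfc, Unitary.conjStarAlgAut_apply, star_eq_conjTranspose]
  congr 3
  ext i
  simp [apply_ite]

lemma posSemidef_posProj_mul (hA : A.IsHermitian) : (posProj hA * A).PosSemidef := by
  have h : posProj hA * A = hA.cfc ((fun x => if 0 < x then 1 else 0) * id) := by
    rw [← hA.cfc_mul_cfc, hA.cfc_id_eq_self, posProj_eq_cfc]
  rw [h]
  refine hA.posSemidef_cfc fun i => ?_
  simp only [Pi.mul_apply, id]
  split_ifs <;> linarith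

lemma posSemidef_neg_negProj_mul (hA : A.IsHermitian) : (-(negProj hA * A)).PosSemidef := by
  have h : -(negProj hA * A) =
      hA.cfc (-((fun x => if x < 0 then 1 else 0) * id)) := by
    rw [← hA.neg_cfc, ← hA.cfc_mul_cfc, hA.cfc_id_eq_self, negProj_eq_cfc]
  rw [h]
  refine hA.posSemidef_cfc fun i => ?_
  simp only [Pi.neg_apply, Pi.mul_apply, id]
  split_ifs <;> linarith

lemma posSemidef_one_sub_posProj_sub_negProj (hA : A.IsHermitian) :
    (1 - posProj hA - negProj hA).PosSemidef := by
  rw [posProj_eq_cfc, negProj_eq_cfc, ← hA.cfc_one_eq_one, hA.cfc_sub_cfc, hA.cfc_sub_cfc]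
  refine hA.posSemidef_cfc fun i => ?_
  simp only [Pi.sub_apply, Pi.one_apply]
  split_ifs <;> linarith

end Projectors

theorem trace_rho2_one_sub_rho2_ge_sum {N : ℕ} (ρ₁ ρ₂ : Matrix (Fin N) (Fin N) ℂ)
    (h₁ : ρ₁.PosSemidef) (h₁' : ρ₁.trace = 1)
    (h₂ : ρ₂.PosSemidef) (h₂' : ρ₂.trace = 1) :
    ((ρ₂ * (1 - ρ₂)).trace).re ≥
      ((posProj (h₁.isHermitian.sub h₂.isHermitian) * (1 - ρ₁) * ρ₂).trace).re + ((negProj (h₁.isHermitian.sub h₂.isHermitian) * ρ₁ * (1 - ρ₂)).trace).re := by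
  have hD := h₁.isHermitian.sub h₂.isHermitian
  have hzero := (posSemidef_one_sub_posProj_sub_negProj hD).re_trace_mul_nonneg_s6
    (h₂.mul_one_sub_of_trace_eq_one h₂')
  have hpos := (posSemidef_posProj_mul hD).re_trace_mul_nonneg_s6 h₂
  have hneg := (posSemidef_neg_negProj_mul hD).re_trace_mul_nonneg_s6
    (h₂.one_sub_of_trace_eq_one_s6 h₂')
  set P := posProj hD
  set Q := negProj hD
  have hdecomp : ρ₂ * (1 - ρ₂) - P * (1 - ρ₁) * ρ₂ - Q * ρ₁ * (1 - ρ₂) =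
      (1 - P - Q) * (ρ₂ * (1 - ρ₂)) + P * (ρ₁ - ρ₂) * ρ₂ +
        -(Q * (ρ₁ - ρ₂)) * (1 - ρ₂) := by
    noncomm_ring
  have htrace := congrArg (fun M => M.trace.re) hdecomp
  simp only [trace_add, trace_sub, Complex.add_re, Complex.sub_re] at htrace
  linarith
end

section
/- Let ρ₁, ρ₂ be density matrices on ℂ^N, let P₊ and P₋ be the orthogonal projectors onto the subspaces spanned by the eigenvectors of the Hermitian matrix ρ₁ − ρ₂ with positive and negative eigenvalues respectively. Then √(tr ρ₁(I − ρ₁)) · √(tr ρ₂(I − ρ₂)) ≥ tr(P₊ (I − ρ₁) ρ₂) + tr(P₋ ρ₁ (I − ρ₂)). -/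
open Matrix ComplexOrder

namespace Matrix.IsHermitian

variable {n : Type*} [Fintype n] [DecidableEq n] {A : Matrix n n ℂ} (hA : A.IsHermitian)

/-- The function `f` applied to the Hermitian matrix `A`. -/
noncomputable def spectralMap (f : ℝ → ℝ) : Matrix n n ℂ :=
  (hA.eigenvectorUnitary : Matrix n n ℂ) *
    diagonal (fun i => (f (hA.eigenvalues i) : ℂ)) *
    (hA.eigenvectorUnitary : Matrix n n ℂ)ᴴ

lemma spectralMap_id : hA.spectralMap id = A := by
  conv_rhs => rw [hA.spectral_theorem, Unitary.conjStarAlgAut_apply]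
  rfl

lemma spectralMap_mul (f g : ℝ → ℝ) :
    hA.spectralMap f * hA.spectralMap g = hA.spectralMap (f * g) := by
  have hU : (hA.eigenvectorUnitary : Matrix n n ℂ)ᴴ * (hA.eigenvectorUnitary : Matrix n n ℂ) = 1 :=
    Unitary.coe_star_mul_self _
  simp only [spectralMap, Pi.mul_apply, Complex.ofReal_mul, ← diagonal_mul_diagonal]
  simp only [Matrix.mul_assoc]
  rw [← Matrix.mul_assoc _ᴴ, hU, Matrix.one_mul]

lemma spectralMap_add (f g : ℝ → ℝ) :
    hA.spectralMap f + hA.spectralMap g = hA.spectralMap (f + g) := by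
  simp only [spectralMap, Pi.add_apply, Complex.ofReal_add, ← diagonal_add, Matrix.mul_add,
    Matrix.add_mul]

lemma spectralMap_sub (f g : ℝ → ℝ) :
    hA.spectralMap f - hA.spectralMap g = hA.spectralMap (f - g) := by
  simp only [spectralMap, Pi.sub_apply, Complex.ofReal_sub, ← diagonal_sub, Matrix.mul_sub,
    Matrix.sub_mul]

lemma spectralMap_one : hA.spectralMap 1 = 1 := by
  have hU : (hA.eigenvectorUnitary : Matrix n n ℂ) * (hA.eigenvectorUnitary : Matrix n n ℂ)ᴴ = 1 :=
    Unitary.coe_mul_star_self _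
  simp [spectralMap, hU]

lemma spectralMap_congr {f g : ℝ → ℝ} (h : ∀ i, f (hA.eigenvalues i) = g (hA.eigenvalues i)) :
    hA.spectralMap f = hA.spectralMap g := by
  simp only [spectralMap, h]

lemma posSemidef_spectralMap {f : ℝ → ℝ} (hf : ∀ i, 0 ≤ f (hA.eigenvalues i)) :
    (hA.spectralMap f).PosSemidef :=
  (PosSemidef.diagonal fun i => by simpa using hf i).mul_mul_conjTranspose_same _

lemma re_trace_spectralMap (f : ℝ → ℝ) :
    (hA.spectralMap f).trace.re = ∑ i, f (hA.eigenvalues i) := by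
  have hU : (hA.eigenvectorUnitary : Matrix n n ℂ)ᴴ * (hA.eigenvectorUnitary : Matrix n n ℂ) = 1 :=
    Unitary.coe_star_mul_self _
  rw [spectralMap, trace_mul_comm, ← Matrix.mul_assoc, hU, Matrix.one_mul, trace_diagonal]
  simp

lemma posProj_eq_spectralMap : posProj hA = hA.spectralMap (fun x => if 0 < x then 1 else 0) := by
  simp only [posProj, spectralMap, apply_ite Complex.ofReal, Complex.ofReal_one,
    Complex.ofReal_zero]

lemma negProj_eq_spectralMap : negProj hA = hA.spectralMap (fun x => if x < 0 then 1 else 0) := by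
  simp only [negProj, spectralMap, apply_ite Complex.ofReal, Complex.ofReal_one,
    Complex.ofReal_zero]

lemma posProj_mul_self_eq_spectralMap : posProj hA * A = hA.spectralMap (fun x => max x 0) := by
  conv_lhs => rw [posProj_eq_spectralMap]; rhs; rw [← hA.spectralMap_id]
  rw [spectralMap_mul]
  refine hA.spectralMap_congr fun i => ?_
  by_cases h : 0 < hA.eigenvalues i
  · simp [h, h.le]
  · simp [h, not_lt.mp h]

lemma posProj_mul_self_sub_eq_spectralMap :
    posProj hA * A - A = hA.spectralMap (fun x => max (-x) 0) := by
  rw [posProj_mul_self_eq_spectralMap]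
  conv_lhs => rhs; rw [← hA.spectralMap_id]
  rw [spectralMap_sub]
  refine hA.spectralMap_congr fun i => ?_
  rcases le_total 0 (hA.eigenvalues i) with h | h <;> simp [h]

lemma posProj_add_negProj_mul_self : (posProj hA + negProj hA) * A = A := by
  conv_lhs => rw [posProj_eq_spectralMap, negProj_eq_spectralMap]; rhs; rw [← hA.spectralMap_id]
  conv_rhs => rw [← hA.spectralMap_id]
  rw [spectralMap_add, spectralMap_mul]
  refine hA.spectralMap_congr fun i => ?_
  rcases lt_trichotomy 0 (hA.eigenvalues i) with h | h | h
  · simp [h, h.le.not_gt]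
  · simp [← h]
  · simp [h, h.le.not_gt]

lemma posSemidef_posProj : (posProj hA).PosSemidef := by
  rw [posProj_eq_spectralMap]
  exact hA.posSemidef_spectralMap fun i => by split_ifs <;> norm_num

lemma posSemidef_one_sub_posProj : (1 - posProj hA).PosSemidef := by
  rw [posProj_eq_spectralMap, ← hA.spectralMap_one, spectralMap_sub]
  exact hA.posSemidef_spectralMap fun i => by simp only [Pi.sub_apply]; split_ifs <;> norm_num

lemma posSemidef_one_sub_posProj_add_negProj : (1 - (posProj hA + negProj hA)).PosSemidef := by
  rw [posProj_eq_spectralMap, negProj_eq_spectralMap, ← hA.spectralMap_one, spectralMap_add,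
    spectralMap_sub]
  refine hA.posSemidef_spectralMap fun i => ?_
  simp only [Pi.sub_apply, Pi.add_apply, Pi.one_apply]
  split_ifs <;> linarith

/-- The sum of the squares of the eigenvalues is at most the square of the sum of the positive
ones plus the square of the sum of the negative ones. -/
lemma re_trace_mul_self_le :
    (A * A).trace.re ≤
      (posProj hA * A).trace.re ^ 2 + ((posProj hA * A).trace.re - A.trace.re) ^ 2 := by
  rw [← Complex.sub_re, ← trace_sub, posProj_mul_self_sub_eq_spectralMap,
    posProj_mul_self_eq_spectralMap]
  conv_lhs => rw [← hA.spectralMap_id]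
  rw [spectralMap_mul]
  simp only [re_trace_spectralMap]
  refine le_trans ?_ (add_le_add
    (Finset.sum_sq_le_sq_sum_of_nonneg fun i _ => le_max_right _ _)
    (Finset.sum_sq_le_sq_sum_of_nonneg fun i _ => le_max_right _ _))
  rw [← Finset.sum_add_distrib]
  refine (Finset.sum_congr rfl fun i _ => ?_).le
  rcases le_total 0 (hA.eigenvalues i) with h | h <;> simp [h, sq]

end Matrix.IsHermitian

namespace Matrix.PosSemidef

variable {n : Type*} [Fintype n] [DecidableEq n]

lemma re_trace_mul_nonneg_s7 {A B : Matrix n n ℂ} (hA : A.PosSemidef) (hB : B.PosSemidef) :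
    0 ≤ (A * B).trace.re := by
  set S := hA.isHermitian.spectralMap Real.sqrt with hS
  have hSS : S * S = A := by
    rw [hS, IsHermitian.spectralMap_mul]
    conv_rhs => rw [← hA.isHermitian.spectralMap_id]
    exact hA.isHermitian.spectralMap_congr fun i => Real.mul_self_sqrt (hA.eigenvalues_nonneg i)
  have hSH : Sᴴ = S :=
    (hA.isHermitian.posSemidef_spectralMap fun i => Real.sqrt_nonneg _).isHermitian
  have h := (hB.mul_mul_conjTranspose_same S).trace_nonneg
  rw [hSH, trace_mul_comm, ← Matrix.mul_assoc, hSS] at h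
  exact (Complex.le_def.mp h).1

lemma eigenvalues_le_one_s7 {A : Matrix n n ℂ} (hA : A.PosSemidef) (htr : A.trace = 1) (i : n) :
    hA.isHermitian.eigenvalues i ≤ 1 := by
  have h := hA.isHermitian.re_trace_spectralMap id
  rw [IsHermitian.spectralMap_id, htr, Complex.one_re] at h
  rw [h]
  exact Finset.single_le_sum (fun j _ => hA.eigenvalues_nonneg j) (Finset.mem_univ i)

lemma mul_one_sub_self {A : Matrix n n ℂ} (hA : A.PosSemidef) (htr : A.trace = 1) :
    (A * (1 - A)).PosSemidef := by
  have h : A * (1 - A) = hA.isHermitian.spectralMap (id * (1 - id)) := by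
    rw [← IsHermitian.spectralMap_mul, ← IsHermitian.spectralMap_sub,
      IsHermitian.spectralMap_id, IsHermitian.spectralMap_one]
  rw [h]
  exact hA.isHermitian.posSemidef_spectralMap fun i =>
    mul_nonneg (hA.eigenvalues_nonneg i) (sub_nonneg.mpr (hA.eigenvalues_le_one_s7 htr i))

end Matrix.PosSemidef

/-- Among operators `0 ≤ S ≤ 1`, the projector `posProj hA` maximizes `tr (S A)`. -/
lemma re_trace_mul_le_re_trace_posProj_mul {n : Type*} [Fintype n] [DecidableEq n]
    {A S : Matrix n n ℂ} (hA : A.IsHermitian) (hS : S.PosSemidef) (hS' : (1 - S).PosSemidef) :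
    (S * A).trace.re ≤ (posProj hA * A).trace.re := by
  have hp := hS'.re_trace_mul_nonneg_s7
    (hA.posProj_mul_self_eq_spectralMap ▸ hA.posSemidef_spectralMap fun i => le_max_right _ _ :
      (posProj hA * A).PosSemidef)
  have hm := hS.re_trace_mul_nonneg_s7
    (hA.posProj_mul_self_sub_eq_spectralMap ▸ hA.posSemidef_spectralMap fun i => le_max_right _ _ :
      (posProj hA * A - A).PosSemidef)
  simp only [Matrix.sub_mul, Matrix.mul_sub, Matrix.one_mul, trace_sub, Complex.sub_re] at hp hm
  linarith

/-- Two-outcome form of the trace distance bound: `a` and `b` are outcome probabilities. -/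
lemma binary_product_le {a b t u v : ℝ} (ha : 0 ≤ a) (ha' : a ≤ 1) (hb : 0 ≤ b) (hb' : b ≤ 1)
    (hab : a - b ≤ t) (hba : b - a ≤ t) (hu : 0 ≤ u) (hv : 0 ≤ v) :
    (u * a - v * b) * (v * (1 - b) - u * (1 - a)) ≤ u * v * t := by
  have huv := mul_nonneg hu hv
  rcases le_total b a with h | h
  · nlinarith [mul_nonneg (mul_nonneg hb (sub_nonneg.mpr ha')) (sq_nonneg (u - v)),
      mul_nonneg (mul_nonneg (sub_nonneg.mpr h) (sub_nonneg.mpr ha')) (sq_nonneg u),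
      mul_nonneg (mul_nonneg (sub_nonneg.mpr h) hb) (sq_nonneg v),
      mul_le_mul_of_nonneg_left hab huv]
  · nlinarith [mul_nonneg (mul_nonneg ha (sub_nonneg.mpr hb')) (sq_nonneg (u - v)),
      mul_nonneg (mul_nonneg (sub_nonneg.mpr h) ha) (sq_nonneg u),
      mul_nonneg (mul_nonneg (sub_nonneg.mpr h) (sub_nonneg.mpr hb')) (sq_nonneg v),
      mul_le_mul_of_nonneg_left hba huv]

/-- A reversed Cauchy-Schwarz defect bound for the form `tr X tr Y - tr (X Y)`. -/
lemma two_mul_one_sub_le {n : Type*} [Fintype n] [DecidableEq n] {A B : Matrix n n ℂ}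
    (hA : A.PosSemidef) (hA' : A.trace = 1) (hB : B.PosSemidef) (hB' : B.trace = 1)
    {u v : ℝ} (hu : 0 ≤ u) (hv : 0 ≤ v) :
    2 * (u * v) * (1 - (A * B).trace.re -
        (posProj (hA.isHermitian.sub hB.isHermitian) * (A - B)).trace.re) ≤
      u ^ 2 * (A * (1 - A)).trace.re + v ^ 2 * (B * (1 - B)).trace.re := by
  set t := (posProj (hA.isHermitian.sub hB.isHermitian) * (A - B)).trace.re with ht
  have hX : (u • A - v • B).IsHermitian :=
    (hA.smul hu).isHermitian.sub (hB.smul hv).isHermitian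
  have hR := hX.posSemidef_posProj
  have hR' := hX.posSemidef_one_sub_posProj
  have hsq := hX.re_trace_mul_self_le
  set R := posProj hX
  have h1 := re_trace_mul_le_re_trace_posProj_mul (hA.isHermitian.sub hB.isHermitian) hR hR'
  have h2 := re_trace_mul_le_re_trace_posProj_mul (hA.isHermitian.sub hB.isHermitian) hR'
    (by simpa using hR)
  have a0 := hR.re_trace_mul_nonneg_s7 hA
  have b0 := hR.re_trace_mul_nonneg_s7 hB
  have a1 := hR'.re_trace_mul_nonneg_s7 hA
  have b1 := hR'.re_trace_mul_nonneg_s7 hB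
  have hBA : (B * A).trace = (A * B).trace := trace_mul_comm _ _
  rw [← ht] at h1 h2
  simp only [Matrix.sub_mul, Matrix.mul_sub, Matrix.one_mul, Matrix.mul_one, trace_sub,
    Complex.sub_re, hA', hB', Complex.one_re, Matrix.smul_mul, Matrix.mul_smul, trace_smul,
    Complex.smul_re, smul_eq_mul, hBA] at h1 h2 a1 b1 hsq ⊢
  have key := binary_product_le a0 (by linarith) b0 (by linarith) h1 (by linarith) hu hv
  nlinarith [key]

lemma le_sqrt_mul_sqrt_of_forall {a b k : ℝ} (ha : 0 ≤ a) (hb : 0 ≤ b)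
    (h : ∀ u, 0 ≤ u → 2 * u * k ≤ u ^ 2 * a + b) : k ≤ √a * √b := by
  rw [← Real.sqrt_mul ha]
  rcases le_total k 0 with hk | hk
  · exact hk.trans (Real.sqrt_nonneg _)
  refine Real.le_sqrt_of_sq_le ?_
  have hd : discrim a (-(2 * k)) b ≤ 0 := discrim_le_zero fun x => by
    rcases le_total 0 x with hx | hx
    · linarith [h x hx]
    · nlinarith [mul_nonneg ha (mul_self_nonneg x), mul_nonneg hk (neg_nonneg.mpr hx)]
  rw [discrim] at hd
  linarith

theorem sqrt_mul_sqrt_ge_sum {N : ℕ} (ρ₁ ρ₂ : Matrix (Fin N) (Fin N) ℂ)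
    (h₁ : ρ₁.PosSemidef) (h₁' : ρ₁.trace = 1)
    (h₂ : ρ₂.PosSemidef) (h₂' : ρ₂.trace = 1) :
    Real.sqrt (((ρ₁ * (1 - ρ₁)).trace).re) * Real.sqrt (((ρ₂ * (1 - ρ₂)).trace).re) ≥
      ((posProj (h₁.isHermitian.sub h₂.isHermitian) * (1 - ρ₁) * ρ₂).trace).re + ((negProj (h₁.isHermitian.sub h₂.isHermitian) * ρ₁ * (1 - ρ₂)).trace).re := by
  have hΔ := h₁.isHermitian.sub h₂.isHermitian
  refine le_trans ?_ (le_sqrt_mul_sqrt_of_forall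
    (k := 1 - (ρ₁ * ρ₂).trace.re - (posProj hΔ * (ρ₁ - ρ₂)).trace.re)
    (Complex.le_def.mp (h₁.mul_one_sub_self h₁').trace_nonneg).1
    (Complex.le_def.mp (h₂.mul_one_sub_self h₂').trace_nonneg).1 fun u hu => ?_)
  · have hsum := hΔ.posProj_add_negProj_mul_self
    have hker := hΔ.posSemidef_one_sub_posProj_add_negProj.re_trace_mul_nonneg_s7
      (h₂.mul_one_sub_self h₂')
    set P := posProj hΔ
    set Q := negProj hΔ
    have htr := congrArg (fun M => M.trace.re) hsum
    have htr' := congrArg (fun M => (M * ρ₂).trace.re) hsum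
    simp only [Matrix.sub_mul, Matrix.mul_sub, Matrix.add_mul, Matrix.one_mul,
      Matrix.mul_one, trace_sub, trace_add, Complex.sub_re, Complex.add_re, h₁', h₂',
      Complex.one_re, Matrix.mul_assoc] at htr htr' hker ⊢
    linarith
  · have h := two_mul_one_sub_le h₁ h₁' h₂ h₂' hu zero_le_one
    linarith
end

section
/- For any two density matrices ρ₁, ρ₂ on ℂ^N, the superfidelity satisfies 0 ≤ G(ρ₁,ρ₂) ≤ 1. -/
open Matrix ComplexOrder

/-- The superfidelity `G(ρ₁,ρ₂) = tr(ρ₁ρ₂) + √(1 - tr ρ₁²) √(1 - tr ρ₂²)`. -/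
noncomputable def superFid {n : Type*} [Fintype n] [DecidableEq n]
    (ρ₁ ρ₂ : Matrix n n ℂ) : ℝ :=
  ((ρ₁ * ρ₂).trace).re +
    Real.sqrt (1 - ((ρ₁ * ρ₁).trace).re) * Real.sqrt (1 - ((ρ₂ * ρ₂).trace).re)

namespace Matrix

variable {n : Type*} [Fintype n] {A B : Matrix n n ℂ}

lemma IsHermitian.trace_mul_eq_sum_eigenvalues [DecidableEq n] (hA : A.IsHermitian)
    (B : Matrix n n ℂ) :
    (A * B).trace = ∑ i, (hA.eigenvalues i : ℂ) *
      ((hA.eigenvectorUnitary : Matrix n n ℂ)ᴴ * B * hA.eigenvectorUnitary) i i := by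
  conv_lhs => rw [hA.spectral_theorem, Unitary.conjStarAlgAut_apply, Matrix.mul_assoc,
    Matrix.mul_assoc, Matrix.trace_mul_comm, Matrix.mul_assoc]
  simp [trace, diagonal_mul, star_eq_conjTranspose]

lemma PosSemidef.trace_mul_nonneg (hA : A.PosSemidef) (hB : B.PosSemidef) :
    0 ≤ (A * B).trace := by
  classical
  rw [hA.1.trace_mul_eq_sum_eigenvalues]
  exact Finset.sum_nonneg fun i _ ↦ mul_nonneg
    (Complex.zero_le_real.2 (hA.eigenvalues_nonneg i))
    (hB.conjTranspose_mul_mul_same _).diag_nonneg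

lemma PosSemidef.trace_mul_le_trace_mul_trace (hA : A.PosSemidef) (hB : B.PosSemidef) :
    (A * B).trace ≤ A.trace * B.trace := by
  classical
  set U := hA.1.eigenvectorUnitary
  have hC := hB.conjTranspose_mul_mul_same (U : Matrix n n ℂ)
  have htr : ((U : Matrix n n ℂ)ᴴ * B * U).trace = B.trace := by
    rw [trace_mul_cycle, ← star_eq_conjTranspose, Unitary.mul_star_self_of_mem U.2, Matrix.one_mul]
  rw [hA.1.trace_mul_eq_sum_eigenvalues, hA.1.trace_eq_sum_eigenvalues, Finset.sum_mul, ← htr]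
  refine Finset.sum_le_sum fun i _ ↦ mul_le_mul_of_nonneg_left ?_
    (Complex.zero_le_real.2 (hA.eigenvalues_nonneg i))
  exact Finset.single_le_sum (f := fun j ↦ ((U : Matrix n n ℂ)ᴴ * B * U) j j)
    (fun j _ ↦ hC.diag_nonneg) (Finset.mem_univ i)

lemma IsHermitian.two_mul_re_trace_mul_le (hA : A.IsHermitian) (hB : B.IsHermitian) :
    2 * (A * B).trace.re ≤ (A * A).trace.re + (B * B).trace.re := by
  have h := (posSemidef_conjTranspose_mul_self (A - B)).trace_nonneg
  rw [(hA.sub hB).eq, Matrix.sub_mul, Matrix.mul_sub, Matrix.mul_sub, trace_sub, trace_sub,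
    trace_sub, trace_mul_comm B A] at h
  have h' := (Complex.le_def.1 h).1
  simp only [Complex.zero_re, Complex.sub_re] at h'
  linarith

end Matrix

theorem superFid_nonneg_le_one {N : ℕ} (ρ₁ ρ₂ : Matrix (Fin N) (Fin N) ℂ)
    (h₁ : ρ₁.PosSemidef) (h₁' : ρ₁.trace = 1)
    (h₂ : ρ₂.PosSemidef) (h₂' : ρ₂.trace = 1) :
    0 ≤ superFid ρ₁ ρ₂ ∧ superFid ρ₁ ρ₂ ≤ 1 := by
  have h₀ : 0 ≤ (ρ₁ * ρ₂).trace.re := (Complex.le_def.1 (h₁.trace_mul_nonneg h₂)).1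
  have purity_le {ρ : Matrix (Fin N) (Fin N) ℂ} (h : ρ.PosSemidef) (h' : ρ.trace = 1) :
      (ρ * ρ).trace.re ≤ 1 := by
    simpa [h'] using (Complex.le_def.1 (h.trace_mul_le_trace_mul_trace h)).1
  have hc := h₁.1.two_mul_re_trace_mul_le h₂.1
  have hs₁ := Real.sq_sqrt (sub_nonneg.2 (purity_le h₁ h₁'))
  have hs₂ := Real.sq_sqrt (sub_nonneg.2 (purity_le h₂ h₂'))
  have hmul := two_mul_le_add_sq (√(1 - (ρ₁ * ρ₁).trace.re)) (√(1 - (ρ₂ * ρ₂).trace.re))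
  unfold superFid
  exact ⟨by positivity, by linarith⟩
end

section
/- For any density matrices ρ₁, ρ₂, ρ₁′, ρ₂′ on ℂ^N and any α ∈ [0,1], the superfidelity is jointly concave: G(αρ₁ + (1−α)ρ₂, αρ₁′ + (1−α)ρ₂′) ≥ α·G(ρ₁,ρ₁′) + (1−α)·G(ρ₂,ρ₂′). -/
open Matrix ComplexOrder

theorem re_trace_mul_self_nonneg {n : Type*} [Fintype n] {A : Matrix n n ℂ}
    (hA : A.IsHermitian) : 0 ≤ ((A * A).trace).re := by
  have h := (posSemidef_conjTranspose_mul_self A).trace_nonneg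
  rw [hA.eq] at h
  exact (Complex.le_def.1 h).1

theorem re_trace_mul_sq_le {n : Type*} [Fintype n] {A B : Matrix n n ℂ}
    (hA : A.IsHermitian) (hB : B.IsHermitian) :
    ((A * B).trace).re ^ 2 ≤ ((A * A).trace).re * ((B * B).trace).re := by
  have key (t : ℝ) : 0 ≤ ((B * B).trace).re * (t * t) + 2 * ((A * B).trace).re * t
      + ((A * A).trace).re := by
    have hherm : (A + (t : ℂ) • B).IsHermitian := by
      refine hA.add ?_
      simp [IsHermitian, conjTranspose_smul, hB.eq]
    have h := re_trace_mul_self_nonneg hherm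
    simp only [add_mul, mul_add, smul_mul_assoc, mul_smul_comm, trace_add, trace_smul,
      trace_mul_comm B A, smul_eq_mul, Complex.add_re, Complex.re_ofReal_mul] at h
    linarith
  have h := discrim_le_zero key
  rw [discrim] at h
  linarith

theorem Matrix.PosSemidef.mul_apply_re_le {n : Type*} {A : Matrix n n ℂ}
    (hA : A.PosSemidef) (i j : n) : (A i j * A j i).re ≤ (A i i * A j j).re := by
  have h := (hA.submatrix ![i, j]).det_nonneg
  rw [det_fin_two] at h
  simpa using (Complex.le_def.1 h).1

theorem Matrix.PosSemidef.re_trace_mul_self_le_one {n : Type*} [Fintype n] {A : Matrix n n ℂ}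
    (hA : A.PosSemidef) (ht : A.trace = 1) : ((A * A).trace).re ≤ 1 := by
  have h : (A.trace * A.trace).re = 1 := by simp [ht]
  rw [← h]
  simp only [trace, diag, mul_apply, Finset.sum_mul_sum, Complex.re_sum]
  exact Finset.sum_le_sum fun i _ => Finset.sum_le_sum fun j _ => hA.mul_apply_re_le i j

/-- Cauchy–Schwarz for weighted triples, with `R` dominated by `√P √Q`. -/
theorem add_add_le_sqrt_mul_sqrt {a b c s₁ s₂ t₁ t₂ P Q R : ℝ}
    (ha : 0 ≤ a) (hb : 0 ≤ b) (hc : 0 ≤ c) (hP : 0 ≤ P) (hQ : 0 ≤ Q) (hR : R ^ 2 ≤ P * Q) :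
    a * (s₁ * t₁) + b * (s₂ * t₂) + c * R ≤
      √(a * s₁ ^ 2 + b * s₂ ^ 2 + c * P) * √(a * t₁ ^ 2 + b * t₂ ^ 2 + c * Q) := by
  have hR' : R ≤ √P * √Q := by
    rw [← Real.sqrt_mul hP]
    exact Real.le_sqrt_of_sq_le hR
  obtain ⟨p, hp⟩ : ∃ p, p = √P := ⟨_, rfl⟩
  obtain ⟨q, hq⟩ : ∃ q, q = √Q := ⟨_, rfl⟩
  have hp2 : P = p ^ 2 := by rw [hp, Real.sq_sqrt hP]
  have hq2 : Q = q ^ 2 := by rw [hq, Real.sq_sqrt hQ]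
  rw [← hp, ← hq] at hR'
  rw [hp2, hq2, ← Real.sqrt_mul (by positivity)]
  calc a * (s₁ * t₁) + b * (s₂ * t₂) + c * R
      ≤ a * (s₁ * t₁) + b * (s₂ * t₂) + c * (p * q) := by gcongr
    _ ≤ _ := by
      apply Real.le_sqrt_of_sq_le
      have h₁ : 0 ≤ a * b * (s₁ * t₂ - s₂ * t₁) ^ 2 := by positivity
      have h₂ : 0 ≤ a * c * (s₁ * q - p * t₁) ^ 2 := by positivity
      have h₃ : 0 ≤ b * c * (s₂ * q - p * t₂) ^ 2 := by positivity
      linarith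

theorem re_trace_convex_comb_mul {n : Type*} [Fintype n] (A B C D : Matrix n n ℂ) (α : ℝ) :
    (((α : ℂ) • A + ((1 - α : ℝ) : ℂ) • B) * ((α : ℂ) • C + ((1 - α : ℝ) : ℂ) • D)).trace.re =
      α * (A * C).trace.re + (1 - α) * (B * D).trace.re
        - α * (1 - α) * ((A - B) * (C - D)).trace.re := by
  simp only [add_mul, mul_add, sub_mul, mul_sub, smul_mul_assoc, mul_smul_comm, trace_add,
    trace_sub, trace_smul, smul_eq_mul, Complex.add_re, Complex.sub_re, Complex.re_ofReal_mul]
  ring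

theorem superFid_jointly_concave {N : ℕ} (ρ₁ ρ₂ ρ₁' ρ₂' : Matrix (Fin N) (Fin N) ℂ)
    (h₁ : ρ₁.PosSemidef) (ht₁ : ρ₁.trace = 1)
    (h₂ : ρ₂.PosSemidef) (ht₂ : ρ₂.trace = 1)
    (h₁' : ρ₁'.PosSemidef) (ht₁' : ρ₁'.trace = 1)
    (h₂' : ρ₂'.PosSemidef) (ht₂' : ρ₂'.trace = 1)
    (α : ℝ) (hα0 : 0 ≤ α) (hα1 : α ≤ 1) :
    superFid ((α : ℂ) • ρ₁ + ((1 - α : ℝ) : ℂ) • ρ₂)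
        ((α : ℂ) • ρ₁' + ((1 - α : ℝ) : ℂ) • ρ₂') ≥
      α * superFid ρ₁ ρ₁' + (1 - α) * superFid ρ₂ ρ₂' := by
  have hu : (ρ₁ - ρ₂).IsHermitian := h₁.isHermitian.sub h₂.isHermitian
  have hv : (ρ₁' - ρ₂').IsHermitian := h₁'.isHermitian.sub h₂'.isHermitian
  have hβ : 0 ≤ 1 - α := sub_nonneg.2 hα1
  have key := add_add_le_sqrt_mul_sqrt (s₁ := √(1 - (ρ₁ * ρ₁).trace.re))
    (s₂ := √(1 - (ρ₂ * ρ₂).trace.re)) (t₁ := √(1 - (ρ₁' * ρ₁').trace.re))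
    (t₂ := √(1 - (ρ₂' * ρ₂').trace.re)) hα0 hβ (mul_nonneg hα0 hβ)
    (re_trace_mul_self_nonneg hu) (re_trace_mul_self_nonneg hv) (re_trace_mul_sq_le hu hv)
  rw [Real.sq_sqrt (sub_nonneg.2 (h₁.re_trace_mul_self_le_one ht₁)),
    Real.sq_sqrt (sub_nonneg.2 (h₂.re_trace_mul_self_le_one ht₂)),
    Real.sq_sqrt (sub_nonneg.2 (h₁'.re_trace_mul_self_le_one ht₁')),
    Real.sq_sqrt (sub_nonneg.2 (h₂'.re_trace_mul_self_le_one ht₂'))] at key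
  have expand (a b c : ℝ) : 1 - (α * a + (1 - α) * b - α * (1 - α) * c) =
      α * (1 - a) + (1 - α) * (1 - b) + α * (1 - α) * c := by ring
  simp only [superFid, re_trace_convex_comb_mul, expand]
  linarith
end

section
/- For any density matrices ρ₁, ρ₂, ρ₃, ρ₄ on ℂ^N, the superfidelity is supermultiplicative with respect to tensor products: G(ρ₁ ⊗ ρ₂, ρ₃ ⊗ ρ₄) ≥ G(ρ₁,ρ₃)·G(ρ₂,ρ₄). -/
open Matrix ComplexOrder
open Kronecker

lemma Matrix.IsHermitian.im_trace_mul {n : Type*} [Fintype n] {A B : Matrix n n ℂ}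
    (hA : A.IsHermitian) (hB : B.IsHermitian) : ((A * B).trace).im = 0 := by
  rw [← Complex.conj_eq_iff_im, starRingEnd_apply, ← Matrix.trace_conjTranspose,
    Matrix.conjTranspose_mul, hA.eq, hB.eq, Matrix.trace_mul_comm]

lemma Matrix.IsHermitian.re_trace_mul_self {n : Type*} [Fintype n] {A : Matrix n n ℂ}
    (hA : A.IsHermitian) : ((A * A).trace).re = ∑ x : n × n, ‖A x.1 x.2‖ ^ 2 := by
  simp only [Matrix.trace, Matrix.diag, Matrix.mul_apply, Complex.re_sum, Fintype.sum_prod_type]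
  refine Finset.sum_congr rfl fun i _ => Finset.sum_congr rfl fun j _ => ?_
  rw [← hA.apply j i, Complex.star_def, Complex.mul_conj, Complex.normSq_eq_norm_sq,
    Complex.ofReal_re]

/-- The Cauchy–Schwarz inequality for the Hilbert–Schmidt inner product. -/
lemma Matrix.IsHermitian.re_trace_mul_le {n : Type*} [Fintype n] {A B : Matrix n n ℂ}
    (hA : A.IsHermitian) (hB : B.IsHermitian) :
    ((A * B).trace).re ≤ √((A * A).trace.re) * √((B * B).trace.re) := by
  rw [hA.re_trace_mul_self, hB.re_trace_mul_self]
  refine le_trans ?_ (Real.sum_mul_le_sqrt_mul_sqrt _ _ _)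
  simp only [Matrix.trace, Matrix.diag, Matrix.mul_apply, Complex.re_sum, Fintype.sum_prod_type]
  refine Finset.sum_le_sum fun i _ => Finset.sum_le_sum fun j _ => ?_
  rw [← hB.apply j i]
  exact (Complex.re_le_norm _).trans (by rw [norm_mul, norm_star])

lemma Matrix.PosSemidef.norm_apply_sq_le {n : Type*} [Fintype n] {A : Matrix n n ℂ}
    (hA : A.PosSemidef) (i j : n) : ‖A i j‖ ^ 2 ≤ (A i i).re * (A j j).re := by
  have h := (Complex.nonneg_iff.1 (hA.submatrix ![i, j]).det_nonneg).1
  have hi : (A i i).im = 0 := (Complex.nonneg_iff.1 hA.diag_nonneg).2.symm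
  rw [Matrix.det_fin_two] at h
  simp only [Matrix.submatrix_apply, Matrix.cons_val_zero, Matrix.cons_val_one] at h
  rw [← hA.isHermitian.apply j i, Complex.star_def, Complex.mul_conj,
    Complex.normSq_eq_norm_sq, Complex.sub_re, Complex.mul_re, Complex.ofReal_re, hi] at h
  linarith

lemma Matrix.PosSemidef.re_trace_mul_self_le {n : Type*} [Fintype n] {A : Matrix n n ℂ}
    (hA : A.PosSemidef) : ((A * A).trace).re ≤ A.trace.re ^ 2 := by
  rw [hA.isHermitian.re_trace_mul_self, Fintype.sum_prod_type, sq, Matrix.trace, Complex.re_sum,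
    Finset.sum_mul_sum]
  exact Finset.sum_le_sum fun i _ => Finset.sum_le_sum fun j _ => hA.norm_apply_sq_le i j

lemma re_trace_kronecker_mul {m n : Type*} [Fintype m] [Fintype n]
    {A C : Matrix m m ℂ} (B D : Matrix n n ℂ) (hA : A.IsHermitian) (hC : C.IsHermitian) :
    (((A ⊗ₖ B) * (C ⊗ₖ D)).trace).re = ((A * C).trace).re * ((B * D).trace).re := by
  rw [← Matrix.mul_kronecker_mul, Matrix.trace_kronecker, Complex.mul_re, hA.im_trace_mul hC]
  ring

lemma superFid_scalar_inequality {a b p q r s : ℝ} (hp : 0 ≤ p) (hq : 0 ≤ q) (hr : 0 ≤ r)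
    (hs : 0 ≤ s) (hp1 : p ≤ 1) (hq1 : q ≤ 1) (hr1 : r ≤ 1) (hs1 : s ≤ 1)
    (ha : a ≤ √p * √r) (hb : b ≤ √q * √s) :
    (a + √(1 - p) * √(1 - r)) * (b + √(1 - q) * √(1 - s)) ≤
      a * b + √(1 - p * q) * √(1 - r * s) := by
  have key := Real.sum_mul_le_sqrt_mul_sqrt Finset.univ
    ![√p * √(1 - q), √q * √(1 - p), √(1 - p) * √(1 - q)]
    ![√r * √(1 - s), √s * √(1 - r), √(1 - r) * √(1 - s)]
  simp only [Fin.sum_univ_three, Matrix.cons_val, mul_pow, Real.sq_sqrt hp, Real.sq_sqrt hq,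
    Real.sq_sqrt hr, Real.sq_sqrt hs, Real.sq_sqrt (sub_nonneg.2 hp1),
    Real.sq_sqrt (sub_nonneg.2 hq1), Real.sq_sqrt (sub_nonneg.2 hr1),
    Real.sq_sqrt (sub_nonneg.2 hs1)] at key
  rw [show p * (1 - q) + q * (1 - p) + (1 - p) * (1 - q) = 1 - p * q by ring,
    show r * (1 - s) + s * (1 - r) + (1 - r) * (1 - s) = 1 - r * s by ring] at key
  have ha' := mul_le_mul_of_nonneg_right ha
    (mul_nonneg (Real.sqrt_nonneg (1 - q)) (Real.sqrt_nonneg (1 - s)))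
  have hb' := mul_le_mul_of_nonneg_right hb
    (mul_nonneg (Real.sqrt_nonneg (1 - p)) (Real.sqrt_nonneg (1 - r)))
  linarith

theorem superFid_supermultiplicative {N : ℕ} (ρ₁ ρ₂ ρ₃ ρ₄ : Matrix (Fin N) (Fin N) ℂ)
    (h₁ : ρ₁.PosSemidef) (ht₁ : ρ₁.trace = 1)
    (h₂ : ρ₂.PosSemidef) (ht₂ : ρ₂.trace = 1)
    (h₃ : ρ₃.PosSemidef) (ht₃ : ρ₃.trace = 1)
    (h₄ : ρ₄.PosSemidef) (ht₄ : ρ₄.trace = 1) :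
    superFid (ρ₁ ⊗ₖ ρ₂) (ρ₃ ⊗ₖ ρ₄) ≥ superFid ρ₁ ρ₃ * superFid ρ₂ ρ₄ := by
  have nonneg {ρ : Matrix (Fin N) (Fin N) ℂ} (h : ρ.PosSemidef) : 0 ≤ ((ρ * ρ).trace).re := by
    rw [h.isHermitian.re_trace_mul_self]
    positivity
  have le_one {ρ : Matrix (Fin N) (Fin N) ℂ} (h : ρ.PosSemidef) (ht : ρ.trace = 1) :
      ((ρ * ρ).trace).re ≤ 1 := by
    simpa [ht] using h.re_trace_mul_self_le
  unfold superFid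
  rw [re_trace_kronecker_mul _ _ h₁.isHermitian h₃.isHermitian,
    re_trace_kronecker_mul _ _ h₁.isHermitian h₁.isHermitian,
    re_trace_kronecker_mul _ _ h₃.isHermitian h₃.isHermitian]
  exact superFid_scalar_inequality (nonneg h₁) (nonneg h₂) (nonneg h₃) (nonneg h₄)
    (le_one h₁ ht₁) (le_one h₂ ht₂) (le_one h₃ ht₃) (le_one h₄ ht₄)
    (h₁.isHermitian.re_trace_mul_le h₃.isHermitian)
    (h₂.isHermitian.re_trace_mul_le h₄.isHermitian)
end

section
/- The function D_G(ρ₁,ρ₂) = √(2 − 2·G(ρ₁,ρ₂)) satisfies the triangle inequality on density matrices: for all density matrices ρ₁, ρ₂, ρ₃ on ℂ^N, D_G(ρ₁,ρ₃) ≤ D_G(ρ₁,ρ₂) + D_G(ρ₂,ρ₃). -/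
open Matrix ComplexOrder

theorem Matrix.IsHermitian.trace_mul_self_eq_sum_eigenvalues_sq {n : Type*} [Fintype n]
    [DecidableEq n] {A : Matrix n n ℂ} (hA : A.IsHermitian) :
    (A * A).trace = ∑ i, (hA.eigenvalues i : ℂ) ^ 2 := by
  conv_lhs => rw [hA.spectral_theorem, ← map_mul, Unitary.conjStarAlgAut_apply, trace_mul_cycle,
    Unitary.coe_star_mul_self, one_mul, diagonal_mul_diagonal, trace_diagonal]
  simp [sq]

theorem Matrix.PosSemidef.re_trace_mul_self_le_sq {n : Type*} [Fintype n] [DecidableEq n]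
    {A : Matrix n n ℂ} (hA : A.PosSemidef) : (A * A).trace.re ≤ A.trace.re ^ 2 := by
  have h := Finset.sum_sq_le_sq_sum_of_nonneg (s := Finset.univ)
    fun i _ => hA.eigenvalues_nonneg i
  rw [hA.isHermitian.trace_mul_self_eq_sum_eigenvalues_sq, hA.isHermitian.trace_eq_sum_eigenvalues]
  simpa [← Complex.ofReal_pow] using h

theorem Matrix.IsHermitian.re_trace_mul_self_eq_sum_norm_sq {n : Type*} [Fintype n]
    {A : Matrix n n ℂ} (hA : A.IsHermitian) :
    (A * A).trace.re = ∑ p : n × n, ‖A p.1 p.2‖ ^ 2 := by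
  rw [Fintype.sum_prod_type, trace, Complex.re_sum]
  refine Finset.sum_congr rfl fun i _ => ?_
  rw [diag_apply, mul_apply, Complex.re_sum]
  refine Finset.sum_congr rfl fun j _ => ?_
  rw [← hA.apply j i, Complex.star_def, Complex.mul_conj', ← Complex.ofReal_pow,
    Complex.ofReal_re]

/-- The entries of a matrix together with `√(1 - tr A²)`, as a Euclidean vector: for density
matrices the distance between two such vectors is `√(2 - 2 G)`. -/
noncomputable def superFidVec {n : Type*} [Fintype n] (A : Matrix n n ℂ) :
    EuclideanSpace ℂ (Option (n × n)) :=
  WithLp.toLp 2 fun o => o.elim (Real.sqrt (1 - (A * A).trace.re) : ℂ) fun p => A p.1 p.2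

theorem dist_superFidVec {n : Type*} [Fintype n] [DecidableEq n] {A B : Matrix n n ℂ}
    (hA : A.PosSemidef) (hA' : A.trace = 1) (hB : B.PosSemidef) (hB' : B.trace = 1) :
    dist (superFidVec A) (superFidVec B) = Real.sqrt (2 - 2 * superFid A B) := by
  have purity_le {C : Matrix n n ℂ} (hC : C.PosSemidef) (hC' : C.trace = 1) :
      0 ≤ 1 - (C * C).trace.re := by
    have := hC.re_trace_mul_self_le_sq
    rw [hC', Complex.one_re, one_pow] at this
    linarith
  have hentries : ∑ p : n × n, dist (A p.1 p.2) (B p.1 p.2) ^ 2 =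
      (A * A).trace.re + (B * B).trace.re - 2 * (A * B).trace.re := by
    have h := (hA.isHermitian.sub hB.isHermitian).re_trace_mul_self_eq_sum_norm_sq
    simp only [Matrix.sub_apply, ← dist_eq_norm] at h
    rw [← h, sub_mul, mul_sub, mul_sub]
    simp only [trace_sub, Complex.sub_re, trace_mul_comm B A]
    ring
  rw [EuclideanSpace.dist_eq, Fintype.sum_option]
  simp only [superFidVec, Option.elim_none, Option.elim_some]
  rw [hentries, Complex.dist_eq, ← Complex.ofReal_sub, Complex.norm_real, Real.norm_eq_abs, sq_abs,
    sub_sq, Real.sq_sqrt (purity_le hA hA'), Real.sq_sqrt (purity_le hB hB'), superFid]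
  congr 1
  ring

/-- The quantity `D_G(ρ₁,ρ₂) = √(2 - 2 G(ρ₁,ρ₂))` satisfies the triangle
inequality on density matrices. -/
theorem superFid_metric_triangle {N : ℕ} (ρ₁ ρ₂ ρ₃ : Matrix (Fin N) (Fin N) ℂ)
    (h₁ : ρ₁.PosSemidef) (h₁' : ρ₁.trace = 1)
    (h₂ : ρ₂.PosSemidef) (h₂' : ρ₂.trace = 1)
    (h₃ : ρ₃.PosSemidef) (h₃' : ρ₃.trace = 1) :
    Real.sqrt (2 - 2 * superFid ρ₁ ρ₃) ≤
      Real.sqrt (2 - 2 * superFid ρ₁ ρ₂) + Real.sqrt (2 - 2 * superFid ρ₂ ρ₃) := by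
  rw [← dist_superFidVec h₁ h₁' h₃ h₃', ← dist_superFidVec h₁ h₁' h₂ h₂',
    ← dist_superFidVec h₂ h₂' h₃ h₃']
  exact dist_triangle _ _ _
end
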